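/- arXiv:2408.04960 — 3 statements merged into one kernel-verified Lean document; each statement's English description precedes it below -/
import Mathlib

section
/- Under the hypotheses of the large-time behavior theorem for (HJ) (assumptions (A1)–(A4), (A6) with u₀ ∈ W^{1,∞}(ℝ), v₀(x)=∫₀ˣu₀, and (A7)), the limit profile V ∈ Lip(𝕋) satisfies a(y₂−y₁) ≤ V(y₂) − V(y₁) ≤ b(y₂−y₁) for all y₁ < y₂, where I = [a,b] is the maximal interval containing 0 on which f is affine and β is constant. Moreover, if I = {0}, then V is constant on 𝕋. -/
open MeasureTheory Set Filter

noncomputable section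

/-- Partial derivative in the first (space) variable. -/
def pdx (v : ℝ → ℝ → ℝ) (x t : ℝ) : ℝ := deriv (fun y => v y t) x

/-- Partial derivative in the second (time) variable. -/
def pdt (v : ℝ → ℝ → ℝ) (x t : ℝ) : ℝ := deriv (fun s => v x s) t

/-- Assumption (A1): `f` is locally Lipschitz, `f (·, u)` is bounded for each `u`, and the
coercivity condition `lim_{|u|→∞} inf_x ½ f(x,u)² − (‖α‖_∞+‖β'‖_∞+1)|∂ₓf(x,u) u| = ∞` holds,
where `Cα`, `Cβ` are the `L^∞` norms of `α` and `β'`. -/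
def A1 (f : ℝ → ℝ → ℝ) (Cα Cβ : ℝ) : Prop :=
  (∀ K : Set (ℝ × ℝ), IsCompact K →
      ∃ L : NNReal, LipschitzOnWith L (fun p : ℝ × ℝ => f p.1 p.2) K) ∧
  (∀ u : ℝ, ∃ C : ℝ, ∀ x : ℝ, |f x u| ≤ C) ∧
  (∀ M : ℝ, ∃ R : ℝ, ∀ u : ℝ, R ≤ |u| → ∀ x : ℝ,
      M ≤ (1 / 2) * (f x u) ^ 2 - (Cα + Cβ + 1) * |deriv (fun y => f y u) x * u|)

/-- Assumption (A2): `∂ₓ f` and `∂ₓ² f` belong to `L¹(ℝₓ ; L^∞_loc(ℝᵤ))`. -/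
def A2 (f : ℝ → ℝ → ℝ) : Prop :=
  ∀ R : ℝ, 0 < R →
    (∃ g : ℝ → ℝ, Integrable g ∧
        ∀ x : ℝ, ∀ u ∈ Icc (-R) R, |deriv (fun y => f y u) x| ≤ g x) ∧
    (∃ g : ℝ → ℝ, Integrable g ∧
        ∀ x : ℝ, ∀ u ∈ Icc (-R) R, |deriv (deriv (fun y => f y u)) x| ≤ g x)

/-- Assumption (A3): `∂ᵤ f` and `∂ᵤ∂ₓ f` belong to `L^∞(ℝₓ ; L^∞_loc(ℝᵤ))`. -/
def A3 (f : ℝ → ℝ → ℝ) : Prop :=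
  ∀ R : ℝ, 0 < R → ∃ C : ℝ, ∀ x : ℝ, ∀ u ∈ Icc (-R) R,
    |deriv (fun w => f x w) u| ≤ C ∧ |deriv (fun w => deriv (fun y => f y w) x) u| ≤ C

/-- Assumption (A4): `α ∈ W^{1,∞}` is nonnegative (with `‖α‖_∞ ≤ Cα`), and
`β ∈ C¹ ∩ Lip` is nondecreasing (with `‖β'‖_∞ ≤ Cβ`). -/
def A4 (α β : ℝ → ℝ) (Cα Cβ : ℝ) : Prop :=
  (∀ x, 0 ≤ α x) ∧ (∀ x, |α x| ≤ Cα) ∧ (∃ L : NNReal, LipschitzWith L α) ∧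
  ContDiff ℝ 1 β ∧ (∃ L : NNReal, LipschitzWith L β) ∧ Monotone β ∧ ∀ u, |deriv β u| ≤ Cβ

/-- Assumption (A5) on the initial datum: `u₀ ∈ W^{1,∞}(ℝ) ∩ BV(ℝ)`. -/
def A5 (u₀ : ℝ → ℝ) : Prop :=
  (∃ L : NNReal, LipschitzWith L u₀) ∧ (∃ C : ℝ, ∀ x, |u₀ x| ≤ C) ∧
  Integrable u₀ ∧ BoundedVariationOn u₀ univ

/-- A convex entropy flux triplet `(η, q, r)`:  `η ∈ C²` is convex and
`∂ᵤq(x,u) = η'(u) ∂ᵤf(x,u)`, `∂ᵤr(x,u) = η'(u)(α(x)+β'(u))` for a.e. `(x,u)`. -/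
def IsEntropyTriplet (f : ℝ → ℝ → ℝ) (α β : ℝ → ℝ) (η : ℝ → ℝ) (q r : ℝ → ℝ → ℝ) : Prop :=
  ContDiff ℝ 2 η ∧ ConvexOn ℝ univ η ∧
  ∀ᵐ p : ℝ × ℝ ∂volume,
    deriv (fun w => q p.1 w) p.2 = deriv η p.2 * deriv (fun w => f p.1 w) p.2 ∧
    deriv (fun w => r p.1 w) p.2 = deriv η p.2 * (α p.1 + deriv β p.2)

/-- Test functions: smooth and compactly supported (on `ℝ × [0,∞)`). -/
def IsTestFn (φ : ℝ → ℝ → ℝ) : Prop :=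
  ContDiff ℝ (⊤ : ℕ∞) (fun p : ℝ × ℝ => φ p.1 p.2) ∧
  HasCompactSupport (fun p : ℝ × ℝ => φ p.1 p.2)

/-- `u ∈ L^∞(ℝ × (0,∞))`. -/
def LinftyHalf (u : ℝ → ℝ → ℝ) : Prop :=
  ∃ C : ℝ, ∀ᵐ p : ℝ × ℝ ∂volume, 0 < p.2 → |u p.1 p.2| ≤ C

/-- `u ∈ C_loc([0,∞) ; L¹(ℝ))`. -/
def ClocL1 (u : ℝ → ℝ → ℝ) : Prop :=
  (∀ t : ℝ, 0 ≤ t → Integrable fun x => u x t) ∧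
  ∀ t : ℝ, 0 ≤ t → ∀ ε : ℝ, 0 < ε → ∃ δ : ℝ, 0 < δ ∧
    ∀ s : ℝ, 0 ≤ s → |s - t| < δ → (∫ x : ℝ, |u x s - u x t|) < ε

/-- Entropy solution of (CL):
`∂ₜu + ∂ₓ f(x,u) = ∂ₓ(α(x) ∂ₓu + ∂ₓ β(u))`, `u(·,0) = u₀`. -/
def IsEntropySolution (f : ℝ → ℝ → ℝ) (α β u₀ : ℝ → ℝ) (u : ℝ → ℝ → ℝ) : Prop :=
  Measurable (fun p : ℝ × ℝ => u p.1 p.2) ∧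
  LinftyHalf u ∧
  (∀ K : Set (ℝ × ℝ), IsCompact K → K ⊆ univ ×ˢ Ioi (0 : ℝ) →
    IntegrableOn (fun p : ℝ × ℝ => (α p.1 + deriv β (u p.1 p.2)) * pdx u p.1 p.2 ^ 2)
      K volume) ∧
  ∀ η : ℝ → ℝ, ∀ q r : ℝ → ℝ → ℝ, IsEntropyTriplet f α β η q r →
    ∀ φ : ℝ → ℝ → ℝ, IsTestFn φ → (∀ x t : ℝ, 0 ≤ t → 0 ≤ φ x t) →
    (∫ t in Ioi (0 : ℝ), ∫ x : ℝ,
        (η (u x t) * pdt φ x t + q x (u x t) * pdx φ x t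
          + r x (u x t) * pdx (pdx φ) x t
          - deriv η (u x t) * deriv (fun y => f y (u x t)) x * φ x t
          + deriv (fun y => q y (u x t)) x * φ x t
          + deriv (fun y => r y (u x t)) x * pdx φ x t))
      + (∫ x : ℝ, η (u₀ x) * φ x 0)
    ≥ ∫ t in Ioi (0 : ℝ), ∫ x : ℝ,
        deriv (deriv η) (u x t) * (α x + deriv β (u x t)) * pdx u x t ^ 2 * φ x t

/-- Viscosity subsolution of (HJ): `∂ₜv + f(x,∂ₓv) = (α(x)+β'(∂ₓv)) ∂ₓ²v`. -/
def IsViscositySubsolution (f : ℝ → ℝ → ℝ) (α β : ℝ → ℝ) (v : ℝ → ℝ → ℝ) : Prop :=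
  ∀ φ : ℝ → ℝ → ℝ, ContDiff ℝ 2 (fun p : ℝ × ℝ => φ p.1 p.2) →
    ∀ x₀ t₀ : ℝ, 0 < t₀ →
      IsLocalMax (fun p : ℝ × ℝ => v p.1 p.2 - φ p.1 p.2) (x₀, t₀) →
      pdt φ x₀ t₀ + f x₀ (pdx φ x₀ t₀) ≤ (α x₀ + deriv β (pdx φ x₀ t₀)) * pdx (pdx φ) x₀ t₀

/-- Viscosity supersolution of (HJ). -/
def IsViscositySupersolution (f : ℝ → ℝ → ℝ) (α β : ℝ → ℝ) (v : ℝ → ℝ → ℝ) : Prop :=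
  ∀ φ : ℝ → ℝ → ℝ, ContDiff ℝ 2 (fun p : ℝ × ℝ => φ p.1 p.2) →
    ∀ x₀ t₀ : ℝ, 0 < t₀ →
      IsLocalMin (fun p : ℝ × ℝ => v p.1 p.2 - φ p.1 p.2) (x₀, t₀) →
      pdt φ x₀ t₀ + f x₀ (pdx φ x₀ t₀) ≥ (α x₀ + deriv β (pdx φ x₀ t₀)) * pdx (pdx φ) x₀ t₀

/-- Viscosity solution of (HJ) with initial datum `v₀`. -/
def IsViscositySolution (f : ℝ → ℝ → ℝ) (α β v₀ : ℝ → ℝ) (v : ℝ → ℝ → ℝ) : Prop :=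
  ContinuousOn (fun p : ℝ × ℝ => v p.1 p.2) (univ ×ˢ Ici (0 : ℝ)) ∧
  IsViscositySubsolution f α β v ∧ IsViscositySupersolution f α β v ∧
  ∀ x : ℝ, v x 0 = v₀ x

/-- `v ∈ Lip(ℝ × [0,∞))`. -/
def LipHalf (v : ℝ → ℝ → ℝ) : Prop :=
  ∃ L : NNReal, LipschitzOnWith L (fun p : ℝ × ℝ => v p.1 p.2) (univ ×ˢ Ici (0 : ℝ))

/-- Classical solution of the viscous Hamilton–Jacobi equation (VHJ):
`∂ₜv + f(x,∂ₓv) = (α(x)+β'(∂ₓv)) ∂ₓ²v + ε ∂ₓ²v`, `v(·,0) = v₀`. -/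
def IsClassicalSolVHJ (f : ℝ → ℝ → ℝ) (α β v₀ : ℝ → ℝ) (ε : ℝ) (v : ℝ → ℝ → ℝ) : Prop :=
  ContinuousOn (fun p : ℝ × ℝ => v p.1 p.2) (univ ×ˢ Ici (0 : ℝ)) ∧
  ContDiffOn ℝ 2 (fun p : ℝ × ℝ => v p.1 p.2) (univ ×ˢ Ioi (0 : ℝ)) ∧
  (∀ x t : ℝ, 0 < t →
    pdt v x t + f x (pdx v x t)
      = (α x + deriv β (pdx v x t)) * pdx (pdx v) x t + ε * pdx (pdx v) x t) ∧
  ∀ x : ℝ, v x 0 = v₀ x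

/-- Classical solution of the viscous conservation law (VCL):
`∂ₜu + ∂ₓ f(x,u) = ∂ₓ(α(x) ∂ₓu + ∂ₓ β(u)) + ε ∂ₓ²u`, `u(·,0) = u₀`. -/
def IsClassicalSolVCL (f : ℝ → ℝ → ℝ) (α β u₀ : ℝ → ℝ) (ε : ℝ) (u : ℝ → ℝ → ℝ) : Prop :=
  ContinuousOn (fun p : ℝ × ℝ => u p.1 p.2) (univ ×ˢ Ici (0 : ℝ)) ∧
  ContDiffOn ℝ 2 (fun p : ℝ × ℝ => u p.1 p.2) (univ ×ˢ Ioi (0 : ℝ)) ∧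
  (∀ x t : ℝ, 0 < t →
    pdt u x t + deriv (fun y => f y (u y t)) x
      = deriv (fun y => α y * pdx u y t + deriv (fun z => β (u z t)) y) x
        + ε * pdx (pdx u) x t) ∧
  ∀ x : ℝ, u x 0 = u₀ x

/-- `z` is a point of `(x₁, x₂)` at which `V - p · id` exceeds its values at `x₁` and `x₂`. -/
def HasPeak (V : ℝ → ℝ) (p : ℝ) : Prop :=
  ∃ x₁ z x₂ : ℝ, x₁ < z ∧ z < x₂ ∧ V x₁ - p * x₁ < V z - p * z ∧ V x₂ - p * x₂ < V z - p * z

lemma IsViscositySupersolution.neg {F B : ℝ → ℝ} {v : ℝ → ℝ → ℝ}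
    (h : IsViscositySupersolution (fun _ u => F u) (fun _ => 0) B v) :
    IsViscositySubsolution (fun _ u => -F (-u)) (fun _ => 0) (fun u => -B (-u))
      (fun x t => -v x t) := by
  intro φ hφ x₀ t₀ ht hmax
  have key := h (fun x t => -φ x t) hφ.neg x₀ t₀ ht (by
    have := hmax.neg
    simpa [sub_eq_add_neg, add_comm] using this)
  have hx : ∀ y t, pdx (fun x t => -φ x t) y t = -pdx φ y t := fun y t => by
    simp [pdx]
  have hxx : pdx (pdx (fun x t => -φ x t)) x₀ t₀ = -pdx (pdx φ) x₀ t₀ := by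
    simp only [pdx, deriv.fun_neg]
  have ht' : pdt (fun x t => -φ x t) x₀ t₀ = -pdt φ x₀ t₀ := by
    simp [pdt]
  have hB : deriv (fun u => -B (-u)) (pdx φ x₀ t₀) = deriv B (-pdx φ x₀ t₀) := by
    rw [deriv.fun_neg, deriv_comp_neg]; simp
  rw [hxx, ht', hx] at key
  rw [hB]
  dsimp only at key ⊢
  linarith

section TravellingParabola

variable (p d c ε κ T : ℝ)

/-- A concave parabola travelling at speed `d`, corrected in time. -/
def travellingParabola (x t : ℝ) : ℝ :=
  p * (x - d * t) - ε * (x - d * t) ^ 2 - c * t + κ * (t - T) ^ 2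

lemma contDiff_travellingParabola :
    ContDiff ℝ 2 (fun q : ℝ × ℝ => travellingParabola p d c ε κ T q.1 q.2) := by
  unfold travellingParabola
  fun_prop

lemma pdx_travellingParabola (x t : ℝ) :
    pdx (travellingParabola p d c ε κ T) x t = p - 2 * ε * (x - d * t) := by
  have h0 : HasDerivAt (fun y : ℝ => y - d * t) 1 x := (hasDerivAt_id x).sub_const _
  have h := (((h0.const_mul p).sub ((h0.pow 2).const_mul ε)).sub_const (c * t)).add_const
    (κ * (t - T) ^ 2)
  refine h.deriv.trans ?_
  push_cast
  ring

lemma pdx_pdx_travellingParabola (x t : ℝ) :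
    pdx (pdx (travellingParabola p d c ε κ T)) x t = -2 * ε := by
  have h0 : HasDerivAt (fun y : ℝ => y - d * t) 1 x := (hasDerivAt_id x).sub_const _
  have h := (h0.const_mul (2 * ε)).const_sub p
  have e : (fun y => pdx (travellingParabola p d c ε κ T) y t)
      = fun y => p - 2 * ε * (y - d * t) :=
    funext fun y => pdx_travellingParabola p d c ε κ T y t
  rw [pdx, e]
  refine h.deriv.trans ?_
  ring

lemma pdt_travellingParabola (x t : ℝ) :
    pdt (travellingParabola p d c ε κ T) x t
      = -d * (p - 2 * ε * (x - d * t)) - c + 2 * κ * (t - T) := by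
  have h0 : HasDerivAt (fun s : ℝ => x - d * s) (-(d * 1)) t :=
    ((hasDerivAt_id t).const_mul d).const_sub x
  have h1 : HasDerivAt (fun s : ℝ => s - T) 1 t := (hasDerivAt_id t).sub_const _
  have h := (((h0.const_mul p).sub ((h0.pow 2).const_mul ε)).sub
    ((hasDerivAt_id t).const_mul c)).add ((h1.pow 2).const_mul κ)
  refine h.deriv.trans ?_
  push_cast
  ring

end TravellingParabola

/-- Testing a subsolution that converges to a travelling profile `V` with parabolas of small
curvature near a peak of `V - p · id`. -/
lemma HasPeak.exists_subsolution_test {F B V : ℝ → ℝ} {v : ℝ → ℝ → ℝ} {c d p : ℝ}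
    (hcont : ContinuousOn (fun q : ℝ × ℝ => v q.1 q.2) (univ ×ˢ Ici (0 : ℝ)))
    (hsub : IsViscositySubsolution (fun _ u => F u) (fun _ => 0) B v)
    (hV : Continuous V)
    (hconv : ∀ ε : ℝ, 0 < ε → ∃ T : ℝ, ∀ t : ℝ, T ≤ t → ∀ x : ℝ,
      |v x t + c * t - V (x - d * t)| < ε)
    (hp : HasPeak V p) {δ : ℝ} (hδ : 0 < δ) :
    ∃ ε q : ℝ, 0 < ε ∧ ε < δ ∧ |q - p| < δ ∧
      F q - c - d * q + 2 * ε * deriv B q ≤ 2 * ε ^ 2 := by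
  obtain ⟨x₁, z, x₂, h1z, hz2, hV1, hV2⟩ := hp
  have hev : ∀ᶠ ε in nhdsWithin (0 : ℝ) (Ioi 0), ε < δ ∧
      V x₁ - p * x₁ + ε * x₁ ^ 2 < V z - p * z + ε * z ^ 2 ∧
      V x₂ - p * x₂ + ε * x₂ ^ 2 < V z - p * z + ε * z ^ 2 ∧
      2 * ε * (|x₁| + |x₂|) < δ := by
    apply eventually_nhdsWithin_of_eventually_nhds
    have lt (A D : ℝ → ℝ) (hA : Continuous A) (hD : Continuous D) (h : A 0 < D 0) :
        ∀ᶠ ε in nhds (0 : ℝ), A ε < D ε :=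
      hA.continuousAt.eventually_lt hD.continuousAt h
    refine (lt (fun ε => ε) (fun _ => δ) (by fun_prop) (by fun_prop) (by simpa)).and
      ((lt _ _ (by fun_prop) (by fun_prop) (by simpa)).and
      ((lt _ _ (by fun_prop) (by fun_prop) (by simpa)).and
      (lt _ (fun _ => δ) (by fun_prop) (by fun_prop) (by simpa))))
  obtain ⟨ε, ⟨hεδ, hE1, hE2, hEδ⟩, hε⟩ := (hev.and self_mem_nhdsWithin).exists
  have hε : 0 < ε := hε
  set h : ℝ → ℝ := fun y => V y - p * y + ε * y ^ 2 with hh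
  obtain ⟨m, hm, hmax⟩ := isCompact_Icc.exists_isMaxOn (f := h)
    (nonempty_Icc.2 (h1z.trans hz2).le) (by fun_prop)
  have hmz : h z ≤ h m := hmax ⟨h1z.le, hz2.le⟩
  have hm1 : h x₁ < h m := lt_of_lt_of_le hE1 hmz
  have hm2 : h x₂ < h m := lt_of_lt_of_le hE2 hmz
  obtain ⟨η, hη, hη1, hη2, hη3⟩ : ∃ η : ℝ, 0 < η ∧ 2 * η ≤ h m - h x₁ ∧
      2 * η ≤ h m - h x₂ ∧ 2 * η ≤ ε ^ 2 := by
    refine ⟨min (min (h m - h x₁) (h m - h x₂)) (ε ^ 2) / 2, ?_, ?_, ?_, ?_⟩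
    · have : 0 < min (min (h m - h x₁) (h m - h x₂)) (ε ^ 2) :=
        lt_min (lt_min (by linarith) (by linarith)) (by positivity)
      linarith
    all_goals rw [mul_div_cancel₀ _ (two_ne_zero)]
    · exact (min_le_left _ _).trans (min_le_left _ _)
    · exact (min_le_left _ _).trans (min_le_right _ _)
    · exact min_le_right _ _
  obtain ⟨T₀, hT₀⟩ := hconv η hη
  set T : ℝ := max T₀ 0 + 2 with hT
  have hTT : T₀ + 2 ≤ T := by rw [hT]; gcongr; exact le_max_left _ _
  have hT2 : 2 ≤ T := by rw [hT]; linarith [le_max_right T₀ 0]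
  set φ := travellingParabola p d c ε (ε ^ 2) T with hφ
  have hw : ∀ y t, T₀ ≤ t →
      |(v (y + d * t) t - φ (y + d * t) t) - (h y - ε ^ 2 * (t - T) ^ 2)| < η := by
    intro y t ht
    have := hT₀ t ht (y + d * t)
    rw [add_sub_cancel_right] at this
    convert this using 2
    simp only [hφ, travellingParabola, hh]
    ring
  have hcw : ContinuousOn (fun q : ℝ × ℝ => v (q.1 + d * q.2) q.2 - φ (q.1 + d * q.2) q.2)
      (Icc x₁ x₂ ×ˢ Icc (T - 1) (T + 1)) := by
    refine ContinuousOn.sub ?_ ?_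
    · refine hcont.comp (f := fun q : ℝ × ℝ => (q.1 + d * q.2, q.2)) (by fun_prop) ?_
      rintro ⟨y, t⟩ ⟨-, ht⟩
      exact ⟨mem_univ _, mem_Ici.2 (by have := ht.1; dsimp at this ⊢; linarith)⟩
    · have := (contDiff_travellingParabola p d c ε (ε ^ 2) T).continuous
      exact (this.comp (f := fun q : ℝ × ℝ => (q.1 + d * q.2, q.2))
        (by fun_prop)).continuousOn
  obtain ⟨⟨y₀, t₀⟩, ⟨hy₀, ht₀⟩, hmax₀⟩ := (isCompact_Icc.prod isCompact_Icc).exists_isMaxOn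
    ⟨(m, T), hm, ⟨by linarith, by linarith⟩⟩ hcw
  dsimp only at hy₀ ht₀
  have hval : h m - η < v (y₀ + d * t₀) t₀ - φ (y₀ + d * t₀) t₀ := by
    have h1 : v (m + d * T) T - φ (m + d * T) T ≤ v (y₀ + d * t₀) t₀ - φ (y₀ + d * t₀) t₀ :=
      hmax₀ (a := (m, T)) ⟨hm, ⟨by simp, by simp⟩⟩
    have h2 := abs_lt.1 (hw m T (by linarith))
    have h3 : ε ^ 2 * (T - T) ^ 2 = 0 := by ring
    linarith [h2.1]
  have hup := (abs_lt.1 (hw y₀ t₀ (by linarith [ht₀.1]))).2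
  have hhy : h y₀ ≤ h m := hmax hy₀
  have hsq : 0 ≤ ε ^ 2 * (t₀ - T) ^ 2 := by positivity
  have hy1 : y₀ ≠ x₁ := by rintro rfl; linarith
  have hy2 : y₀ ≠ x₂ := by rintro rfl; linarith
  have ht1 : t₀ ≠ T - 1 := by
    intro e
    have : ε ^ 2 * (t₀ - T) ^ 2 = ε ^ 2 := by rw [e]; ring
    linarith
  have ht2 : t₀ ≠ T + 1 := by
    intro e
    have : ε ^ 2 * (t₀ - T) ^ 2 = ε ^ 2 := by rw [e]; ring
    linarith
  have hloc : IsLocalMax (fun q : ℝ × ℝ => v q.1 q.2 - φ q.1 q.2) (y₀ + d * t₀, t₀) := by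
    have hU : Icc x₁ x₂ ×ˢ Icc (T - 1) (T + 1) ∈ nhds (y₀, t₀) :=
      prod_mem_nhds (Icc_mem_nhds (lt_of_le_of_ne hy₀.1 hy1.symm) (lt_of_le_of_ne hy₀.2 hy2))
        (Icc_mem_nhds (lt_of_le_of_ne ht₀.1 ht1.symm) (lt_of_le_of_ne ht₀.2 ht2))
    have htend : Tendsto (fun q : ℝ × ℝ => (q.1 - d * q.2, q.2)) (nhds (y₀ + d * t₀, t₀))
        (nhds (y₀, t₀)) := by
      have : Continuous (fun q : ℝ × ℝ => (q.1 - d * q.2, q.2)) := by fun_prop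
      convert this.tendsto (y₀ + d * t₀, t₀) using 3
      simp
    filter_upwards [htend.eventually hU] with q hq
    simpa using hmax₀ hq
  have key := hsub φ (contDiff_travellingParabola p d c ε (ε ^ 2) T) (y₀ + d * t₀) t₀
    (by linarith [ht₀.1]) hloc
  rw [hφ, pdt_travellingParabola, pdx_pdx_travellingParabola, pdx_travellingParabola,
    add_sub_cancel_right] at key
  refine ⟨ε, p - 2 * ε * y₀, hε, hεδ, ?_, ?_⟩
  · have e : p - 2 * ε * y₀ - p = -(2 * ε * y₀) := by ring
    rw [e, abs_neg, abs_mul, abs_of_pos (by positivity : 0 < 2 * ε)]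
    refine lt_of_le_of_lt (mul_le_mul_of_nonneg_left ?_ (by positivity)) hEδ
    rw [abs_le]
    constructor
    · linarith [neg_abs_le x₁, abs_nonneg x₂, hy₀.1]
    · linarith [le_abs_self x₂, abs_nonneg x₁, hy₀.2]
  · have : -ε ^ 2 ≤ ε ^ 2 * (t₀ - T) := by nlinarith [sq_nonneg ε, ht₀.1]
    dsimp only at key
    linarith

lemma HasPeak.flux_le {F B V : ℝ → ℝ} {v : ℝ → ℝ → ℝ} {c d p : ℝ}
    (hcont : ContinuousOn (fun q : ℝ × ℝ => v q.1 q.2) (univ ×ˢ Ici (0 : ℝ)))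
    (hsub : IsViscositySubsolution (fun _ u => F u) (fun _ => 0) B v)
    (hV : Continuous V) (hF : Continuous F) (hB : Monotone B)
    (hconv : ∀ ε : ℝ, 0 < ε → ∃ T : ℝ, ∀ t : ℝ, T ≤ t → ∀ x : ℝ,
      |v x t + c * t - V (x - d * t)| < ε)
    (hp : HasPeak V p) : F p ≤ c + d * p := by
  by_contra! hlt
  have hG : Continuous fun u => F u - c - d * u := by fun_prop
  obtain ⟨δ, hδ, hball⟩ := Metric.eventually_nhds_iff.1
    (hG.continuousAt.eventually_const_lt
      (show (F p - c - d * p) / 2 < F p - c - d * p by linarith))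
  have hg : 0 < F p - c - d * p := by linarith
  obtain ⟨ε, q, hε, hεδ, hq, hineq⟩ := hp.exists_subsolution_test hcont hsub hV hconv
    (δ := min δ (min 1 ((F p - c - d * p) / 4)))
    (lt_min hδ (lt_min one_pos (by linarith)))
  have h1 := hball (y := q) (by rw [Real.dist_eq]; exact hq.trans_le (min_le_left _ _))
  have h2 : 0 ≤ deriv B q := hB.deriv_nonneg
  have h3 : ε < 1 := hεδ.trans_le ((min_le_right _ _).trans (min_le_left _ _))
  have h4 : ε < (F p - c - d * p) / 4 :=
    hεδ.trans_le ((min_le_right _ _).trans (min_le_right _ _))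
  have h5 : 0 ≤ ε * deriv B q := by positivity
  nlinarith

lemma HasPeak.deriv_eq_zero {F B V : ℝ → ℝ} {v : ℝ → ℝ → ℝ} {c d p : ℝ}
    (hcont : ContinuousOn (fun q : ℝ × ℝ => v q.1 q.2) (univ ×ˢ Ici (0 : ℝ)))
    (hsub : IsViscositySubsolution (fun _ u => F u) (fun _ => 0) B v)
    (hV : Continuous V) (hB : Monotone B) (hB' : Continuous (deriv B))
    (hconv : ∀ ε : ℝ, 0 < ε → ∃ T : ℝ, ∀ t : ℝ, T ≤ t → ∀ x : ℝ,
      |v x t + c * t - V (x - d * t)| < ε)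
    (hp : HasPeak V p) (hF : ∀ᶠ u in nhds p, F u = c + d * u) : deriv B p = 0 := by
  by_contra hne
  have hpos : 0 < deriv B p := lt_of_le_of_ne hB.deriv_nonneg (Ne.symm hne)
  obtain ⟨δ, hδ, hball⟩ := Metric.eventually_nhds_iff.1
    ((hB'.continuousAt.eventually_const_lt (half_lt_self hpos)).and hF)
  obtain ⟨ε, q, hε, hεδ, hq, hineq⟩ := hp.exists_subsolution_test hcont hsub hV hconv
    (δ := min δ (deriv B p / 2)) (lt_min hδ (half_pos hpos))
  obtain ⟨h1, h2⟩ := hball (y := q)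
    (by rw [Real.dist_eq]; exact hq.trans_le (min_le_left _ _))
  have h3 : ε < deriv B p / 2 := hεδ.trans_le (min_le_right _ _)
  nlinarith

lemma hasPeak_and_hasPeak_neg {V : ℝ → ℝ} (hV : Function.Periodic V 1) {x y p : ℝ} {N : ℕ}
    (hxy : x < y) (hyN : y < x + N)
    (h₁ : p * (y - x) < V y - V x) (h₂ : V (x + N) - V y < p * (x + N - y)) :
    HasPeak V p ∧ HasPeak (fun u => -V u) (-p) := by
  have hN (u : ℝ) : V (u + N) = V u := by simpa using hV.nat_mul N u
  have hN' (u : ℝ) : V (u - N) = V u := by simpa using hV.sub_nat_mul_eq N (x := u)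
  refine ⟨⟨x, y, x + N, hxy, hyN, by linarith, by linarith⟩, ?_⟩
  exact ⟨y - N, x, y, by linarith, hxy, by dsimp only; rw [hN']; rw [hN] at h₂; linarith,
    by dsimp only; linarith⟩

/-- If a periodic limit profile rises somewhere, then the equation is linear transport for all
slopes between those of the descending and the ascending chords. -/
lemma flux_affine_and_diffusion_const {f β V : ℝ → ℝ} {v : ℝ → ℝ → ℝ} {c d x y : ℝ} {N : ℕ}
    (hcont : ContinuousOn (fun q : ℝ × ℝ => v q.1 q.2) (univ ×ˢ Ici (0 : ℝ)))
    (hsub : IsViscositySubsolution (fun _ u => f u) (fun _ => 0) β v)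
    (hsup : IsViscositySupersolution (fun _ u => f u) (fun _ => 0) β v)
    (hV : Continuous V) (hVper : Function.Periodic V 1)
    (hf : Continuous f) (hβ : ContDiff ℝ 1 β) (hβm : Monotone β)
    (hconv : ∀ ε : ℝ, 0 < ε → ∃ T : ℝ, ∀ t : ℝ, T ≤ t → ∀ x : ℝ,
      |v x t + c * t - V (x - d * t)| < ε)
    (hxy : x < y) (hyN : y < x + N) (hVxy : V x < V y) :
    ∀ u ∈ Icc ((V (x + N) - V y) / (x + N - y)) ((V y - V x) / (y - x)),
      f u = c + d * u ∧ β u = β 0 := by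
  have hN : V (x + N) = V x := by simpa using hVper.nat_mul N x
  set r := (V (x + N) - V y) / (x + N - y)
  set s := (V y - V x) / (y - x)
  have hr0 : r < 0 := div_neg_of_neg_of_pos (by linarith) (by linarith)
  have hs0 : 0 < s := div_pos (by linarith) (by linarith)
  have hpk : ∀ p ∈ Ioo r s, HasPeak V p ∧ HasPeak (fun u => -V u) (-p) := fun p hp =>
    hasPeak_and_hasPeak_neg hVper hxy hyN ((lt_div_iff₀ (by linarith)).1 hp.2)
      ((div_lt_iff₀ (by linarith)).1 hp.1)
  have hfIoo : EqOn f (fun u => c + d * u) (Ioo r s) := by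
    intro p hp
    obtain ⟨h1, h2⟩ := hpk p hp
    refine le_antisymm (h1.flux_le hcont hsub hV hf hβm hconv) ?_
    have := h2.flux_le (F := fun u => -f (-u)) (B := fun u => -β (-u)) (c := -c) (d := d)
      hcont.neg hsup.neg hV.neg (by fun_prop)
      (fun a b hab => neg_le_neg (hβm (neg_le_neg hab)))
      (fun ε hε => by
        obtain ⟨T, hT⟩ := hconv ε hε
        refine ⟨T, fun t ht x => ?_⟩
        rw [← abs_neg]
        convert hT t ht x using 2
        simp only [Pi.neg_apply]
        ring)
    rw [neg_neg] at this
    dsimp only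
    linarith
  have hβ' : EqOn (deriv β) 0 (Ioo r s) := fun p hp =>
    (hpk p hp).1.deriv_eq_zero hcont hsub hV hβm (hβ.continuous_deriv le_rfl) hconv
      (Filter.eventually_of_mem (Ioo_mem_nhds hp.1 hp.2) hfIoo)
  have hβIoo : EqOn β (fun _ => β 0) (Ioo r s) := fun p hp =>
    isOpen_Ioo.is_const_of_deriv_eq_zero isPreconnected_Ioo
      (hβ.differentiable one_ne_zero).differentiableOn hβ' hp ⟨hr0, hs0⟩
  have hcl : closure (Ioo r s) = Icc r s := closure_Ioo (hr0.trans hs0).ne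
  intro u hu
  rw [← hcl] at hu
  exact ⟨hfIoo.closure hf (by fun_prop) hu, hβIoo.closure hβ.continuous (by fun_prop) hu⟩

lemma A1.continuous {f : ℝ → ℝ} {Cα Cβ : ℝ} (h : A1 (fun _ u => f u) Cα Cβ) :
    Continuous f := by
  rw [continuous_iff_continuousAt]
  intro u
  obtain ⟨L, hL⟩ := h.1 ({0} ×ˢ Icc (u - 1) (u + 1)) (isCompact_singleton.prod isCompact_Icc)
  have : ContinuousOn f (Icc (u - 1) (u + 1)) :=
    hL.continuousOn.comp (f := fun w : ℝ => ((0 : ℝ), w)) (by fun_prop)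
      fun w hw => ⟨rfl, hw⟩
  exact this.continuousAt (Icc_mem_nhds (by linarith) (by linarith))

/-- Two intervals around `0` on which `f` is affine and `β` is constant, one of which has `0` in
its interior, have a union with the same property. -/
lemma Icc_subset_of_maximal_affine {f β : ℝ → ℝ} {a b r s c d : ℝ} (ha : a ≤ 0) (hb : 0 ≤ b)
    (hI : ∃ c₁ c₂ c₃ : ℝ, ∀ u ∈ Icc a b, f u = c₁ * u + c₂ ∧ β u = c₃)
    (hImax : ∀ a' b' : ℝ, a' ≤ a → b ≤ b' →
      (∃ c₁ c₂ c₃ : ℝ, ∀ u ∈ Icc a' b', f u = c₁ * u + c₂ ∧ β u = c₃) → a' = a ∧ b' = b)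
    (hr : r < 0) (hs : 0 < s) (h : ∀ u ∈ Icc r s, f u = c + d * u ∧ β u = β 0) :
    a ≤ r ∧ s ≤ b := by
  obtain ⟨c₁, c₂, c₃, hI⟩ := hI
  have h0 := hI 0 ⟨ha, hb⟩
  have h0' := h 0 ⟨hr.le, hs.le⟩
  have hc₂ : c₂ = c := by linarith
  have key := hImax (min a r) (max b s) (min_le_left _ _) (le_max_left _ _) ⟨d, c, β 0, by
    rintro u ⟨hu1, hu2⟩
    rcases lt_or_ge u r with hur | hur
    · have hau : a ≤ u := (min_le_iff.1 hu1).resolve_right hur.not_ge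
      have e := (hI r ⟨by linarith, by linarith⟩).1.symm.trans (h r ⟨le_rfl, by linarith⟩).1
      have hcd : c₁ = d := mul_right_cancel₀ hr.ne (by linarith)
      have := hI u ⟨hau, by linarith⟩
      rw [hcd, hc₂] at this
      exact ⟨this.1, this.2.trans h0.2.symm⟩
    rcases lt_or_ge s u with hus | hus
    · have hub : u ≤ b := (le_max_iff.1 hu2).resolve_right hus.not_ge
      have e := (hI s ⟨by linarith, by linarith⟩).1.symm.trans (h s ⟨by linarith, le_rfl⟩).1
      have hcd : c₁ = d := mul_right_cancel₀ hs.ne' (by linarith)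
      have := hI u ⟨by linarith, hub⟩
      rw [hcd, hc₂] at this
      exact ⟨this.1, this.2.trans h0.2.symm⟩
    · have := h u ⟨hur, hus⟩
      exact ⟨by linarith [this.1], this.2⟩⟩
  exact ⟨min_eq_left_iff.1 key.1, max_eq_left_iff.1 key.2⟩

/-- Under the hypotheses of the large-time behavior theorem for (HJ),
the limit profile `V` satisfies `a (y₂−y₁) ≤ V(y₂) − V(y₁) ≤ b (y₂−y₁)` for `y₁ < y₂`,
where `I = [a,b]` is the maximal interval containing `0` on which `f` is affine and `β` is
constant; if `I = {0}` then `V` is constant. -/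
theorem large_time_profile_bounds_HJ
    (f β u₀ v₀ : ℝ → ℝ) (Cβ : ℝ) (a b : ℝ)
    (hA1 : A1 (fun _ u => f u) 0 Cβ) (hA2 : A2 (fun _ u => f u)) (hA3 : A3 (fun _ u => f u))
    (hA4 : A4 (fun _ => 0) β 0 Cβ)
    (hu₀lip : ∃ L : NNReal, LipschitzWith L u₀) (hu₀bd : ∃ C : ℝ, ∀ x, |u₀ x| ≤ C)
    (hv₀ : ∀ x : ℝ, v₀ x = ∫ y in (0:ℝ)..x, u₀ y)
    -- (A6): periodicity
    (hu₀per : Function.Periodic u₀ 1) (hv₀per : Function.Periodic v₀ 1)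
    -- `I = [a,b]` is the maximal interval containing `0` on which `f` is affine and `β` constant
    (ha : a ≤ 0) (hb : 0 ≤ b)
    (hI : ∃ c₁ c₂ c₃ : ℝ, ∀ u ∈ Icc a b, f u = c₁ * u + c₂ ∧ β u = c₃)
    (hImax : ∀ a' b' : ℝ, a' ≤ a → b ≤ b' →
      (∃ c₁ c₂ c₃ : ℝ, ∀ u ∈ Icc a' b', f u = c₁ * u + c₂ ∧ β u = c₃) → a' = a ∧ b' = b)
    (v : ℝ → ℝ → ℝ) (hv : IsViscositySolution (fun _ u => f u) (fun _ => 0) β v₀ v)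
    -- the limit profile `V ∈ Lip(𝕋)` and speed `d`
    (V : ℝ → ℝ) (d : ℝ)
    (hVlip : ∃ L : NNReal, LipschitzWith L V) (hVper : Function.Periodic V 1)
    (hconv : ∀ ε : ℝ, 0 < ε → ∃ T : ℝ, ∀ t : ℝ, T ≤ t → ∀ x : ℝ,
      |v x t + f 0 * t - V (x - d * t)| < ε) :
    (∀ y₁ y₂ : ℝ, y₁ < y₂ →
      a * (y₂ - y₁) ≤ V y₂ - V y₁ ∧ V y₂ - V y₁ ≤ b * (y₂ - y₁)) ∧
    (a = 0 → b = 0 → ∃ c : ℝ, ∀ x : ℝ, V x = c) := by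
  obtain ⟨L, hL⟩ := hVlip
  obtain ⟨hcont, hsub, hsup, -⟩ := hv
  have chord : ∀ x y : ℝ, ∀ N : ℕ, x < y → y < x + N → V x < V y →
      a ≤ (V (x + N) - V y) / (x + N - y) ∧ (V y - V x) / (y - x) ≤ b := by
    intro x y N hxy hyN hVxy
    have hN : V (x + N) = V x := by simpa using hVper.nat_mul N x
    exact Icc_subset_of_maximal_affine ha hb hI hImax
      (div_neg_of_neg_of_pos (by linarith) (by linarith))
      (div_pos (by linarith) (by linarith))
      (flux_affine_and_diffusion_const hcont hsub hsup hL.continuous hVper hA1.continuous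
        hA4.2.2.2.1 hA4.2.2.2.2.2.1 hconv hxy hyN hVxy)
  have bounds : ∀ y₁ y₂ : ℝ, y₁ < y₂ →
      a * (y₂ - y₁) ≤ V y₂ - V y₁ ∧ V y₂ - V y₁ ≤ b * (y₂ - y₁) := by
    intro y₁ y₂ h
    have h' : 0 < y₂ - y₁ := sub_pos.2 h
    obtain ⟨N, hN⟩ := exists_nat_gt (y₂ - y₁)
    constructor
    · rcases le_or_gt (V y₁) (V y₂) with hle | hlt
      · have := mul_nonpos_of_nonpos_of_nonneg ha h'.le
        linarith
      · have hper : V (y₂ - N) = V y₂ := by simpa using hVper.sub_nat_mul_eq N (x := y₂)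
        have := (chord (y₂ - N) y₁ N (by linarith) (by linarith) (by linarith)).1
        rw [sub_add_cancel] at this
        exact (le_div_iff₀ h').1 this
    · rcases le_or_gt (V y₂) (V y₁) with hle | hlt
      · have := mul_nonneg hb h'.le
        linarith
      · exact (div_le_iff₀ h').1 (chord y₁ y₂ N h (by linarith) hlt).2
  refine ⟨bounds, fun ha0 hb0 => ⟨V 0, fun x => ?_⟩⟩
  subst ha0 hb0
  rcases lt_trichotomy x 0 with hx | rfl | hx
  · have := bounds x 0 hx
    linarith
  · rfl
  · have := bounds 0 x hx
    linarith
end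
end

section
/- Let ε > 0, f ∈ C²(ℝ×ℝ), α ∈ C²(ℝ), β ∈ C³(ℝ), and let u : ℝ×(0,∞) → ℝ be a C³ classical solution of (VCL). Define w(x,t) := −f(x,u) + α(x)∂ₓu + ∂ₓ(β(u(x,t))) + ε∂ₓu. Then ∂ₓw = ∂ₜu pointwise, and w satisfies pointwise the linear parabolic equation ∂ₜw + (∂ᵤf)(x,u)∂ₓw = α(x)∂²ₓw + ∂ₓ((β′(u) + ε)∂ₓw) on ℝ×(0,∞). -/
open MeasureTheory Set Filter

noncomputable section

section PartialDerivatives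

variable {v : ℝ → ℝ → ℝ} {x t : ℝ}

lemma hasDerivAt_slice_fst_fderiv (h : DifferentiableAt ℝ (fun p : ℝ × ℝ => v p.1 p.2) (x, t)) :
    HasDerivAt (fun y => v y t) (fderiv ℝ (fun p : ℝ × ℝ => v p.1 p.2) (x, t) (1, 0)) x :=
  h.hasFDerivAt.comp_hasDerivAt (f := fun y : ℝ => (y, t)) x
    ((hasDerivAt_id x).prodMk (hasDerivAt_const x t))

lemma hasDerivAt_slice_snd_fderiv (h : DifferentiableAt ℝ (fun p : ℝ × ℝ => v p.1 p.2) (x, t)) :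
    HasDerivAt (fun s => v x s) (fderiv ℝ (fun p : ℝ × ℝ => v p.1 p.2) (x, t) (0, 1)) t :=
  h.hasFDerivAt.comp_hasDerivAt (f := fun s : ℝ => (x, s)) t
    ((hasDerivAt_const t x).prodMk (hasDerivAt_id t))

lemma hasDerivAt_pdx (h : DifferentiableAt ℝ (fun p : ℝ × ℝ => v p.1 p.2) (x, t)) :
    HasDerivAt (fun y => v y t) (pdx v x t) x :=
  (hasDerivAt_slice_fst_fderiv h).differentiableAt.hasDerivAt

lemma hasDerivAt_pdt (h : DifferentiableAt ℝ (fun p : ℝ × ℝ => v p.1 p.2) (x, t)) :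
    HasDerivAt (fun s => v x s) (pdt v x t) t :=
  (hasDerivAt_slice_snd_fderiv h).differentiableAt.hasDerivAt

lemma pdx_eventuallyEq_fderiv (h : ContDiffAt ℝ 1 (fun p : ℝ × ℝ => v p.1 p.2) (x, t)) :
    (fun p : ℝ × ℝ => pdx v p.1 p.2) =ᶠ[nhds (x, t)]
      fun p => fderiv ℝ (fun p : ℝ × ℝ => v p.1 p.2) p (1, 0) := by
  filter_upwards [h.eventually (by simp)] with p hp
  exact (hasDerivAt_slice_fst_fderiv (hp.differentiableAt one_ne_zero)).deriv

lemma pdt_eventuallyEq_fderiv (h : ContDiffAt ℝ 1 (fun p : ℝ × ℝ => v p.1 p.2) (x, t)) :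
    (fun p : ℝ × ℝ => pdt v p.1 p.2) =ᶠ[nhds (x, t)]
      fun p => fderiv ℝ (fun p : ℝ × ℝ => v p.1 p.2) p (0, 1) := by
  filter_upwards [h.eventually (by simp)] with p hp
  exact (hasDerivAt_slice_snd_fderiv (hp.differentiableAt one_ne_zero)).deriv

lemma contDiffAt_pdx {m n : WithTop ℕ∞} (hmn : m + 1 ≤ n)
    (h : ContDiffAt ℝ n (fun p : ℝ × ℝ => v p.1 p.2) (x, t)) :
    ContDiffAt ℝ m (fun p : ℝ × ℝ => pdx v p.1 p.2) (x, t) :=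
  ((h.fderiv_right hmn).clm_apply contDiffAt_const).congr_of_eventuallyEq
    (pdx_eventuallyEq_fderiv (h.of_le (le_trans le_add_self hmn)))

lemma contDiffAt_pdt {m n : WithTop ℕ∞} (hmn : m + 1 ≤ n)
    (h : ContDiffAt ℝ n (fun p : ℝ × ℝ => v p.1 p.2) (x, t)) :
    ContDiffAt ℝ m (fun p : ℝ × ℝ => pdt v p.1 p.2) (x, t) :=
  ((h.fderiv_right hmn).clm_apply contDiffAt_const).congr_of_eventuallyEq
    (pdt_eventuallyEq_fderiv (h.of_le (le_trans le_add_self hmn)))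

lemma pdt_pdx_comm (h : ContDiffAt ℝ 2 (fun p : ℝ × ℝ => v p.1 p.2) (x, t)) :
    pdt (pdx v) x t = pdx (pdt v) x t := by
  have h1 : ContDiffAt ℝ 1 (fun p : ℝ × ℝ => v p.1 p.2) (x, t) := h.of_le one_le_two
  have hd : DifferentiableAt ℝ (fderiv ℝ (fun p : ℝ × ℝ => v p.1 p.2)) (x, t) :=
    (h.fderiv_right (m := 1) one_add_one_eq_two.le).differentiableAt one_ne_zero
  have hx := (contDiffAt_pdx one_add_one_eq_two.le h).differentiableAt one_ne_zero
  have ht := (contDiffAt_pdt one_add_one_eq_two.le h).differentiableAt one_ne_zero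
  rw [pdt, (hasDerivAt_slice_snd_fderiv hx).deriv, pdx, (hasDerivAt_slice_fst_fderiv ht).deriv,
    (pdx_eventuallyEq_fderiv h1).fderiv_eq, (pdt_eventuallyEq_fderiv h1).fderiv_eq,
    fderiv_clm_apply hd (differentiableAt_const _), fderiv_clm_apply hd (differentiableAt_const _)]
  simpa using (h.isSymmSndFDerivAt (by simp)).eq (0, 1) (1, 0)

end PartialDerivatives

/-- If `u` is a `C³` classical solution of (VCL) on `ℝ × (0,∞)` and
`w = −f(x,u) + α ∂ₓu + ∂ₓβ(u) + ε ∂ₓu`, then `∂ₓw = ∂ₜu` and `w` solves the linear parabolic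
equation `∂ₜw + ∂ᵤf(x,u) ∂ₓw = α ∂ₓ²w + ∂ₓ((β'(u)+ε) ∂ₓw)`. -/
theorem flux_equation_VCL
    (ε : ℝ) (hε : 0 < ε) (f : ℝ → ℝ → ℝ) (α β : ℝ → ℝ)
    (hfC2 : ContDiff ℝ 2 (fun p : ℝ × ℝ => f p.1 p.2))
    (hαC2 : ContDiff ℝ 2 α) (hβC3 : ContDiff ℝ 3 β)
    (u : ℝ → ℝ → ℝ)
    (hu : ContDiffOn ℝ 3 (fun p : ℝ × ℝ => u p.1 p.2) (univ ×ˢ Ioi (0:ℝ)))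
    (hpde : ∀ x t : ℝ, 0 < t →
      pdt u x t + deriv (fun y => f y (u y t)) x
        = deriv (fun y => α y * pdx u y t + deriv (fun z => β (u z t)) y) x
          + ε * pdx (pdx u) x t)
    (w : ℝ → ℝ → ℝ)
    (hw : ∀ x t : ℝ, w x t
      = -f x (u x t) + α x * pdx u x t + deriv (fun y => β (u y t)) x + ε * pdx u x t) :
    (∀ x t : ℝ, 0 < t → pdx w x t = pdt u x t) ∧
    (∀ x t : ℝ, 0 < t →
      pdt w x t + deriv (fun z => f x z) (u x t) * pdx w x t
        = α x * pdx (pdx w) x t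
          + deriv (fun y => (deriv β (u y t) + ε) * pdx w y t) x) := by
  have hC : ∀ x t : ℝ, 0 < t → ContDiffAt ℝ 3 (fun p : ℝ × ℝ => u p.1 p.2) (x, t) :=
    fun x t ht => hu.contDiffAt ((isOpen_univ.prod isOpen_Ioi).mem_nhds ⟨mem_univ _, ht⟩)
  have hU : ∀ x t : ℝ, 0 < t → DifferentiableAt ℝ (fun p : ℝ × ℝ => u p.1 p.2) (x, t) :=
    fun x t ht => (hC x t ht).differentiableAt (by norm_num)
  have hUx : ∀ x t : ℝ, 0 < t → ContDiffAt ℝ 2 (fun p : ℝ × ℝ => pdx u p.1 p.2) (x, t) :=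
    fun x t ht => contDiffAt_pdx (by norm_num) (hC x t ht)
  have hUx' : ∀ x t : ℝ, 0 < t → DifferentiableAt ℝ (fun p : ℝ × ℝ => pdx u p.1 p.2) (x, t) :=
    fun x t ht => (hUx x t ht).differentiableAt (by norm_num)
  have hUt : ∀ x t : ℝ, 0 < t → DifferentiableAt ℝ (fun p : ℝ × ℝ => pdt u p.1 p.2) (x, t) :=
    fun x t ht => (contDiffAt_pdt (m := 2) (by norm_num) (hC x t ht)).differentiableAt (by norm_num)
  have hf : Differentiable ℝ (fun p : ℝ × ℝ => f p.1 p.2) := hfC2.differentiable (by norm_num)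
  have hα : Differentiable ℝ α := hαC2.differentiable (by norm_num)
  have hβ : Differentiable ℝ β := hβC3.differentiable (by norm_num)
  have hβ' : Differentiable ℝ (deriv β) :=
    ((contDiff_succ_iff_deriv (n := 2)).1 (by simpa [two_add_one_eq_three] using hβC3)).2.2
      |>.differentiable (by norm_num)
  have hβu : ∀ x t : ℝ, 0 < t →
      deriv (fun y => β (u y t)) x = deriv β (u x t) * pdx u x t := fun x t ht =>
    ((hβ _).hasDerivAt.comp x (hasDerivAt_pdx (hU x t ht))).deriv
  have hβ'x : ∀ x t : ℝ, 0 < t → HasDerivAt (fun y => deriv β (u y t))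
      (deriv (deriv β) (u x t) * pdx u x t) x := fun x t ht =>
    (hβ' _).hasDerivAt.comp x (hasDerivAt_pdx (hU x t ht))
  have hβ't : ∀ x t : ℝ, 0 < t → HasDerivAt (fun s => deriv β (u x s))
      (deriv (deriv β) (u x t) * pdt u x t) t := fun x t ht =>
    (hβ' _).hasDerivAt.comp t (hasDerivAt_pdt (hU x t ht))
  have hwx : ∀ x t : ℝ, 0 < t → pdx w x t = pdt u x t := by
    intro x t ht
    have hfx : DifferentiableAt ℝ (fun y => f y (u y t)) x :=
      (hf (x, u x t)).comp x (f := fun y => (y, u y t))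
        (differentiableAt_id.prodMk (hasDerivAt_pdx (hU x t ht)).differentiableAt)
    have hux := hasDerivAt_pdx (hUx' x t ht)
    have hβx : DifferentiableAt ℝ (fun y => deriv (fun z => β (u z t)) y) x := by
      simp only [hβu _ t ht]
      exact ((hβ'x x t ht).mul hux).differentiableAt
    have hA : DifferentiableAt ℝ (fun y => α y * pdx u y t + deriv (fun z => β (u z t)) y) x :=
      ((hα x).mul hux.differentiableAt).add hβx
    have key := ((hfx.hasDerivAt.neg.add hA.hasDerivAt).add (hux.const_mul ε)).deriv
    have hwt : (fun y => w y t) = (-(fun y => f y (u y t))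
        + fun y => α y * pdx u y t + deriv (fun z => β (u z t)) y)
        + fun y => ε * pdx u y t := by
      funext y
      simp only [hw, Pi.add_apply, Pi.neg_apply]
      ring
    rw [pdx, hwt, key]
    linarith [hpde x t ht]
  refine ⟨hwx, fun x t ht => ?_⟩
  have hut := hasDerivAt_pdt (hU x t ht)
  have huxt := hasDerivAt_pdt (hUx' x t ht)
  rw [pdt_pdx_comm ((hC x t ht).of_le (by norm_num))] at huxt
  have hutx := hasDerivAt_pdx (hUt x t ht)
  have hfu : HasDerivAt (fun s => f x (u x s))
      (deriv (fun z => f x z) (u x t) * pdt u x t) t :=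
    HasDerivAt.comp t (hasDerivAt_pdt (hf (x, u x t))) hut
  have hwt : pdt w x t = -(deriv (fun z => f x z) (u x t) * pdt u x t)
      + α x * pdx (pdt u) x t
      + (deriv (deriv β) (u x t) * pdt u x t * pdx u x t + deriv β (u x t) * pdx (pdt u) x t)
      + ε * pdx (pdt u) x t := by
    refine ((((hfu.neg.add (huxt.const_mul (α x))).add ((hβ't x t ht).mul huxt)).add
      (huxt.const_mul ε)).congr_of_eventuallyEq ?_).deriv
    filter_upwards [eventually_gt_nhds ht] with s hs
    simp [hw, hβu x s hs]
  have hwxx : pdx (pdx w) x t = pdx (pdt u) x t := by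
    simp only [pdx.eq_1 (pdx w), hwx _ t ht]
    rfl
  have hflux := (((hβ'x x t ht).add_const ε).mul hutx).deriv
  have hR : deriv (fun y => (deriv β (u y t) + ε) * pdx w y t) x
      = deriv (deriv β) (u x t) * pdx u x t * pdt u x t
        + (deriv β (u x t) + ε) * pdx (pdt u) x t := by
    simp only [hwx _ t ht]
    exact hflux
  rw [hwt, hwxx, hR, hwx x t ht]
  ring
end
end

section
/- Let f ∈ Lip_loc(ℝ), β ∈ C¹(ℝ)∩Lip(ℝ) nondecreasing, d ∈ ℝ, and U ∈ L∞(𝕋) with ∫_𝕋 U(y) dy = 0; set V(x) := ∫₀ˣ U(y) dy, a Lipschitz ℤ-periodic function. Suppose f(u) − du = f(0) and β′(u) = 0 for every u ∈ [ess inf_𝕋 U, ess sup_𝕋 U]. Then the function ṽ(x,t) := V(x − dt) is a viscosity solution of ∂ₜṽ + f(∂ₓṽ) − f(0) = β′(∂ₓṽ)∂²ₓṽ on ℝ×(0,∞). -/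
open MeasureTheory Set Filter

noncomputable section

/-- If the increments of `V` are bounded by slopes `m` and `M` and `V - g` has a local maximum at
`x`, then the derivative of `g` at `x` lies in `[m, M]`. -/
theorem hasDerivAt_mem_Icc_of_isLocalMax_sub {V g : ℝ → ℝ} {m M p x : ℝ}
    (hm : ∀ a b, a ≤ b → m * (b - a) ≤ V b - V a)
    (hM : ∀ a b, a ≤ b → V b - V a ≤ M * (b - a))
    (hg : HasDerivAt g p x) (hmax : IsLocalMax (fun y => V y - g y) x) : p ∈ Icc m M := by
  have hslope := hasDerivAt_iff_tendsto_slope.1 hg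
  constructor
  · refine ge_of_tendsto (hslope.mono_left (nhdsWithin_mono x fun y hy => ne_of_gt hy) :
      Tendsto (slope g x) (nhdsWithin x (Ioi x)) (nhds p)) ?_
    filter_upwards [hmax.filter_mono nhdsWithin_le_nhds, self_mem_nhdsWithin] with y hy hxy
    rw [mem_Ioi] at hxy
    rw [slope_def_field, le_div_iff₀ (by linarith)]
    linarith [hm x y hxy.le]
  · refine le_of_tendsto (hslope.mono_left (nhdsWithin_mono x fun y hy => ne_of_lt hy) :
      Tendsto (slope g x) (nhdsWithin x (Iio x)) (nhds p)) ?_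
    filter_upwards [hmax.filter_mono nhdsWithin_le_nhds, self_mem_nhdsWithin] with y hy hxy
    rw [mem_Iio] at hxy
    rw [slope_def_field, div_le_iff_of_neg (by linarith)]
    linarith [hM y x hxy.le]

/-- Local minimum counterpart of `hasDerivAt_mem_Icc_of_isLocalMax_sub`. -/
theorem hasDerivAt_mem_Icc_of_isLocalMin_sub {V g : ℝ → ℝ} {m M p x : ℝ}
    (hm : ∀ a b, a ≤ b → m * (b - a) ≤ V b - V a)
    (hM : ∀ a b, a ≤ b → V b - V a ≤ M * (b - a))
    (hg : HasDerivAt g p x) (hmin : IsLocalMin (fun y => V y - g y) x) : p ∈ Icc m M := by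
  have hmax : IsLocalMax (fun y => -V y - -g y) x := by
    simpa only [neg_sub_neg, neg_sub] using hmin.neg
  have h := hasDerivAt_mem_Icc_of_isLocalMax_sub (V := fun y => -V y) (m := -M) (M := -m)
    (fun a b hab => by linarith [hM a b hab]) (fun a b hab => by linarith [hm a b hab])
    hg.neg hmax
  exact ⟨by linarith [h.2], by linarith [h.1]⟩

/-- A primitive of an essentially bounded function has increments controlled by the essential
infimum and supremum. -/
theorem integral_increment_bounds {U : ℝ → ℝ} (hU : Measurable U)
    (hbd : ∃ C : ℝ, ∀ᵐ x : ℝ ∂volume, |U x| ≤ C) {a b : ℝ} (hab : a ≤ b) :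
    essInf U volume * (b - a) ≤ (∫ y in (0:ℝ)..b, U y) - ∫ y in (0:ℝ)..a, U y ∧
    (∫ y in (0:ℝ)..b, U y) - (∫ y in (0:ℝ)..a, U y) ≤ essSup U volume * (b - a) := by
  obtain ⟨C, hC⟩ := hbd
  have hint : ∀ a b : ℝ, IntervalIntegrable U volume a b := fun a b =>
    (intervalIntegrable_const (c := C)).mono_fun hU.aestronglyMeasurable
      (ae_restrict_of_ae (hC.mono fun x hx => hx.trans (le_abs_self C)))
  have hle : ∀ᵐ x : ℝ ∂volume, U x ≤ essSup U volume :=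
    ae_le_essSup ⟨C, hC.mono fun x hx => (abs_le.1 hx).2⟩
  have hge : ∀ᵐ x : ℝ ∂volume, essInf U volume ≤ U x :=
    ae_essInf_le ⟨-C, hC.mono fun x hx => (abs_le.1 hx).1⟩
  rw [intervalIntegral.integral_interval_sub_left (hint 0 b) (hint 0 a)]
  have hlow := intervalIntegral.integral_mono_ae hab intervalIntegrable_const (hint a b) hge
  have hupp := intervalIntegral.integral_mono_ae hab (hint a b) intervalIntegrable_const hle
  rw [intervalIntegral.integral_const, smul_eq_mul] at hlow hupp
  constructor <;> linarith

/-- At a local extremum of `V (x - d t) - φ`, the test function satisfies the transport equation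
`∂ₜφ + d ∂ₓφ = 0`. -/
theorem pdt_eq_of_isLocalExtr_travelingWave {V : ℝ → ℝ} {φ : ℝ → ℝ → ℝ} {d x t : ℝ}
    (hφ : DifferentiableAt ℝ (fun p : ℝ × ℝ => φ p.1 p.2) (x, t))
    (hext : IsLocalExtr (fun p : ℝ × ℝ => V (p.1 - d * p.2) - φ p.1 p.2) (x, t)) :
    pdt φ x t = -d * pdx φ x t := by
  obtain ⟨L, hL⟩ := hφ
  have hx : HasDerivAt (fun y => φ y t) (L (1, 0)) x :=
    HasFDerivAt.comp_hasDerivAt (f := fun y : ℝ => (y, t)) x hL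
      ((hasDerivAt_id x).prodMk (hasDerivAt_const x t))
  have ht : HasDerivAt (fun s => φ x s) (L (0, 1)) t :=
    HasFDerivAt.comp_hasDerivAt (f := fun s : ℝ => (x, s)) t hL
      ((hasDerivAt_const t x).prodMk (hasDerivAt_id t))
  have hline : HasDerivAt (fun s : ℝ => (x + d * s, t + s)) (d, 1) 0 := by
    simpa using (((hasDerivAt_id (0:ℝ)).const_mul d).const_add x).prodMk
      ((hasDerivAt_id (0:ℝ)).const_add t)
  have hzero : (x, t) = (x + d * 0, t + 0) := by simp
  have hcomp : HasDerivAt (fun s => φ (x + d * s) (t + s)) (L (d, 1)) 0 := by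
    rw [hzero] at hL
    exact HasFDerivAt.comp_hasDerivAt (f := fun s : ℝ => (x + d * s, t + s)) 0 hL hline
  have hextr : IsLocalExtr (fun s => V (x - d * t) - φ (x + d * s) (t + s)) 0 := by
    rw [hzero] at hext
    have h := IsExtrFilter.comp_tendsto (g := fun s : ℝ => (x + d * s, t + s)) hext
      hline.continuousAt
    have hconst : ∀ s, x + d * s - d * (t + s) = x - d * t := fun s => by ring
    simpa only [IsLocalExtr, Function.comp_def, hconst] using h
  have hL0 : L (d, 1) = 0 := by simpa using hextr.hasDerivAt_eq_zero (hcomp.const_sub _)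
  have hsplit : L (d, 1) = d * L (1, 0) + L (0, 1) := by
    rw [← smul_eq_mul, ← map_smul, ← map_add]
    simp
  rw [pdt, pdx, hx.deriv, ht.deriv]
  linarith

/-- If `U ∈ L^∞(𝕋)` has zero mean, `V(x) = ∫₀ˣ U`, and `f(u) − d u = f(0)`,
`β'(u) = 0` for every `u ∈ [ess inf U, ess sup U]`, then the traveling wave
`ṽ(x,t) = V(x − d t)` is a viscosity solution of `∂ₜṽ + f(∂ₓṽ) − f(0) = β'(∂ₓṽ) ∂ₓ²ṽ`
on `ℝ × (0,∞)`. -/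
theorem traveling_wave_viscosity_solution
    (f β : ℝ → ℝ) (d : ℝ) (U : ℝ → ℝ)
    (hflip : ∀ K : Set ℝ, IsCompact K → ∃ L : NNReal, LipschitzOnWith L f K)
    (hβ : ContDiff ℝ 1 β) (hβlip : ∃ L : NNReal, LipschitzWith L β) (hβmono : Monotone β)
    (hUmeas : Measurable U) (hUbd : ∃ C : ℝ, ∀ᵐ x : ℝ ∂volume, |U x| ≤ C)
    (hUper : Function.Periodic U 1)
    (hUmean : (∫ y in (0:ℝ)..1, U y) = 0)
    (V : ℝ → ℝ) (hV : ∀ x : ℝ, V x = ∫ y in (0:ℝ)..x, U y)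
    (hflat : ∀ u ∈ Icc (essInf U volume) (essSup U volume),
      f u - d * u = f 0 ∧ deriv β u = 0) :
    IsViscositySubsolution (fun _ p => f p - f 0) (fun _ => 0) β (fun x t => V (x - d * t)) ∧
    IsViscositySupersolution (fun _ p => f p - f 0) (fun _ => 0) β
      (fun x t => V (x - d * t)) := by
  have hm : ∀ a b, a ≤ b → essInf U volume * (b - a) ≤ V b - V a := fun a b hab => by
    rw [hV, hV]
    exact (integral_increment_bounds hUmeas hUbd hab).1
  have hM : ∀ a b, a ≤ b → V b - V a ≤ essSup U volume * (b - a) := fun a b hab => by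
    rw [hV, hV]
    exact (integral_increment_bounds hUmeas hUbd hab).2
  have hx : ∀ φ : ℝ → ℝ → ℝ, ContDiff ℝ 2 (fun p : ℝ × ℝ => φ p.1 p.2) → ∀ x t : ℝ,
      HasDerivAt (fun y => φ y t) (pdx φ x t) x := fun φ hφ x t =>
    ((hφ.comp (contDiff_id.prodMk contDiff_const : ContDiff ℝ 2 fun y : ℝ => (y, t))).differentiable
      two_ne_zero x).hasDerivAt
  have hshift_m : ∀ c a b, a ≤ b → essInf U volume * (b - a) ≤ V (b - c) - V (a - c) :=
    fun c a b hab => by simpa using hm (a - c) (b - c) (by linarith)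
  have hshift_M : ∀ c a b, a ≤ b → V (b - c) - V (a - c) ≤ essSup U volume * (b - a) :=
    fun c a b hab => by simpa using hM (a - c) (b - c) (by linarith)
  have hslice : ∀ x t : ℝ, Tendsto (fun y : ℝ => (y, t)) (nhds x) (nhds (x, t)) := fun x t =>
    (continuous_id.prodMk continuous_const).tendsto x
  constructor
  · intro φ hφ x t _ hmax
    have htr := pdt_eq_of_isLocalExtr_travelingWave (hφ.differentiable two_ne_zero _) hmax.isExtr
    have hmem := hasDerivAt_mem_Icc_of_isLocalMax_sub (hshift_m (d * t)) (hshift_M (d * t))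
      (hx φ hφ x t)
      (IsMaxFilter.comp_tendsto (g := fun y : ℝ => (y, t)) hmax (hslice x t))
    obtain ⟨hf, hb⟩ := hflat _ hmem
    rw [hb, htr]
    linarith
  · intro φ hφ x t _ hmin
    have htr := pdt_eq_of_isLocalExtr_travelingWave (hφ.differentiable two_ne_zero _) hmin.isExtr
    have hmem := hasDerivAt_mem_Icc_of_isLocalMin_sub (hshift_m (d * t)) (hshift_M (d * t))
      (hx φ hφ x t)
      (IsMinFilter.comp_tendsto (g := fun y : ℝ => (y, t)) hmin (hslice x t))
    obtain ⟨hf, hb⟩ := hflat _ hmem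
    rw [hb, htr]
    linarith
end
end
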